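/- Let S ⊆ B₁ ⊂ ℝⁿ be a bounded open convex set, let T ≥ 1/λ, and let u be continuous on S̄ × [0,T], convex in x for each fixed t and nondecreasing in t for each fixed x, and a viscosity supersolution of u_t ≥ λ (det D²u)^p in S × (0,T]. If u(x,0) ≥ −1 for all x ∈ S and u(x,0) ≥ 0 for all x ∈ ∂S, then u(x,t) ≥ −1/2 for all x ∈ S and all t ∈ [1/λ, T]. -/

import Mathlib

open Set Metric MeasureTheory
open scoped RealInnerProductSpace

noncomputable section

abbrev E (n : ℕ) := EuclideanSpace ℝ (Fin n)

variable {n : ℕ}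

/-- The time derivative `∂ₜφ(x,t)`. -/
noncomputable def timeDeriv (φ : E n → ℝ → ℝ) (x : E n) (t : ℝ) : ℝ :=
  deriv (φ x) t

/-- The spatial Hessian matrix `D²φ(x,t)` (in the standard coordinates). -/
noncomputable def hessMatrix (φ : E n → ℝ → ℝ) (x : E n) (t : ℝ) :
    Matrix (Fin n) (Fin n) ℝ :=
  Matrix.of fun i j =>
    fderiv ℝ (fun y => fderiv ℝ (fun z => φ z t) y (EuclideanSpace.single j (1:ℝ))) x
      (EuclideanSpace.single i (1:ℝ))

/-- `φ` is an admissible test function near `(x₀,t₀)`: C² in `x` and C¹ in `t` nearby. -/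
def IsTestAt (φ : E n → ℝ → ℝ) (x₀ : E n) (t₀ : ℝ) : Prop :=
  ∃ ε > (0:ℝ),
    (∀ t ∈ ball t₀ ε, ContDiffOn ℝ 2 (fun x => φ x t) (ball x₀ ε)) ∧
    (∀ x ∈ ball x₀ ε, ContDiffOn ℝ 1 (fun t => φ x t) (ball t₀ ε))

/-- `u - φ` attains a local maximum at `(x₀,t₀)` among times `t ≤ t₀`,
relative to `closure Ω × [t₁,t₂]`. -/
def LocalMaxBelow (Ω : Set (E n)) (t₁ t₂ : ℝ) (u φ : E n → ℝ → ℝ)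
    (x₀ : E n) (t₀ : ℝ) : Prop :=
  ∃ ε > (0:ℝ), ∀ x ∈ closure Ω, ∀ t ∈ Icc t₁ t₂, t ≤ t₀ →
    dist x x₀ < ε → dist t t₀ < ε →
    u x t - φ x t ≤ u x₀ t₀ - φ x₀ t₀

/-- `u - φ` attains a local minimum at `(x₀,t₀)` among times `t ≤ t₀`. -/
def LocalMinBelow (Ω : Set (E n)) (t₁ t₂ : ℝ) (u φ : E n → ℝ → ℝ)
    (x₀ : E n) (t₀ : ℝ) : Prop :=
  ∃ ε > (0:ℝ), ∀ x ∈ closure Ω, ∀ t ∈ Icc t₁ t₂, t ≤ t₀ →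
    dist x x₀ < ε → dist t t₀ < ε →
    u x₀ t₀ - φ x₀ t₀ ≤ u x t - φ x t

/-- Viscosity subsolution of `u_t ≤ Λ (det D²u)^p` on `Ω × [t₁,t₂]`. -/
def ViscSubsolution (Lam p : ℝ) (Ω : Set (E n)) (t₁ t₂ : ℝ) (u : E n → ℝ → ℝ) : Prop :=
  ∀ x₀ ∈ Ω, ∀ t₀ ∈ Ioc t₁ t₂, ∀ φ : E n → ℝ → ℝ, IsTestAt φ x₀ t₀ →
    LocalMaxBelow Ω t₁ t₂ u φ x₀ t₀ →
    timeDeriv φ x₀ t₀ ≤ Lam * max (hessMatrix φ x₀ t₀).det 0 ^ p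

/-- Viscosity supersolution of `u_t ≥ λ (det D²u)^p` on `Ω × [t₁,t₂]`. -/
def ViscSupersolution (lam p : ℝ) (Ω : Set (E n)) (t₁ t₂ : ℝ) (u : E n → ℝ → ℝ) : Prop :=
  ∀ x₀ ∈ Ω, ∀ t₀ ∈ Ioc t₁ t₂, ∀ φ : E n → ℝ → ℝ, IsTestAt φ x₀ t₀ →
    LocalMinBelow Ω t₁ t₂ u φ x₀ t₀ →
    (hessMatrix φ x₀ t₀).PosSemidef →
    lam * (hessMatrix φ x₀ t₀).det ^ p ≤ timeDeriv φ x₀ t₀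

/-- The regularity/structure assumptions: continuity on `closure Ω × [t₁,t₂]`,
convexity in `x`, monotonicity in `t`. -/
structure ParabolicRegular (Ω : Set (E n)) (t₁ t₂ : ℝ) (u : E n → ℝ → ℝ) : Prop where
  cont : ContinuousOn (fun q : E n × ℝ => u q.1 q.2) (closure Ω ×ˢ Icc t₁ t₂)
  conv : ∀ t ∈ Icc t₁ t₂, ConvexOn ℝ (closure Ω) (fun x => u x t)
  mono : ∀ x ∈ closure Ω, ∀ s ∈ Icc t₁ t₂, ∀ t ∈ Icc t₁ t₂, s ≤ t → u x s ≤ u x t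

/-- Viscosity solution of `λ (det D²u)^p ≤ u_t ≤ Λ (det D²u)^p` on `Ω × [t₁,t₂]`. -/
def ViscositySolution (lam Lam p : ℝ) (Ω : Set (E n)) (t₁ t₂ : ℝ) (u : E n → ℝ → ℝ) : Prop :=
  ParabolicRegular Ω t₁ t₂ u ∧ ViscSubsolution Lam p Ω t₁ t₂ u ∧
    ViscSupersolution lam p Ω t₁ t₂ u

/-- `w` is `C^{1,α}` at `x₀` (relative to the set `D`) with some finite constant. -/
def C1AlphaAt (w : E n → ℝ) (D : Set (E n)) (α : ℝ) (x₀ : E n) : Prop :=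
  ∃ C a : ℝ, ∃ q : E n, ∀ x ∈ D, |w x - (a + ⟪q, x - x₀⟫)| ≤ C * ‖x - x₀‖ ^ (1 + α)

/-- `w` is `C^{1,α}` at `x₀` in the direction `e` (relative to the set `D`). -/
def C1AlphaDirAt (w : E n → ℝ) (D : Set (E n)) (α : ℝ) (x₀ e : E n) : Prop :=
  ∃ C a q : ℝ, ∀ s : ℝ, x₀ + s • e ∈ D →
    |w (x₀ + s • e) - (a + q * s)| ≤ C * |s| ^ (1 + α)

/-- A convex set `S` is `d`-balanced with respect to `x₀`. -/
def DBalanced (d : ℝ) (S : Set (E n)) (x₀ : E n) : Prop :=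
  ∃ A : E n →ₗ[ℝ] E n, Function.Bijective A ∧
    ball (0 : E n) 1 ⊆ A '' ((fun y => y - x₀) '' S) ∧
    A '' ((fun y => y - x₀) '' S) ⊆ ball (0 : E n) d

/-- `x₀` is an extremal point of the convex set `D`. -/
def ExtremalPoint (D : Set (E n)) (x₀ : E n) : Prop :=
  ¬ ∃ y ∈ closure D, ∃ z ∈ closure D, ∃ t : ℝ,
      0 < t ∧ t < 1 ∧ y ≠ z ∧ x₀ = t • y + (1 - t) • z

/-- The paraboloid `‖x‖² / 2 - 3 / 2 + c t`, rising at constant speed `c`. -/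
def risingParaboloid (c : ℝ) (x : E n) (t : ℝ) : ℝ :=
  ‖x‖ ^ 2 / 2 - 3 / 2 + c * t

theorem continuous_risingParaboloid (c : ℝ) :
    Continuous fun q : E n × ℝ => risingParaboloid c q.1 q.2 := by
  unfold risingParaboloid
  fun_prop

theorem isTestAt_risingParaboloid (c : ℝ) (x₀ : E n) (t₀ : ℝ) :
    IsTestAt (risingParaboloid c) x₀ t₀ := by
  refine ⟨1, one_pos, fun t _ => ?_, fun x _ => ?_⟩
  · have h : ContDiff ℝ 2 fun x : E n => ‖x‖ ^ 2 / 2 - 3 / 2 + c * t :=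
      (((contDiff_norm_sq ℝ).div_const 2).sub contDiff_const).add contDiff_const
    exact h.contDiffOn
  · have h : ContDiff ℝ 1 fun t : ℝ => ‖x‖ ^ 2 / 2 - 3 / 2 + c * t :=
      contDiff_const.add (contDiff_const.mul contDiff_id)
    exact h.contDiffOn

theorem timeDeriv_risingParaboloid (c : ℝ) (x : E n) (t : ℝ) :
    timeDeriv (risingParaboloid c) x t = c := by
  have h : HasDerivAt (fun s : ℝ => ‖x‖ ^ 2 / 2 - 3 / 2 + c * s) (c * 1) t :=
    ((hasDerivAt_id t).const_mul c).const_add _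
  exact h.deriv.trans (mul_one c)

theorem fderiv_risingParaboloid_apply (c : ℝ) (y v : E n) (t : ℝ) :
    fderiv ℝ (fun z => risingParaboloid c z t) y v = ⟪y, v⟫ := by
  have h : HasFDerivAt (fun z : E n => ‖z‖ ^ 2 * (1 / 2) - 3 / 2 + c * t) _ y :=
    (((hasStrictFDerivAt_norm_sq y).hasFDerivAt.mul_const (1 / 2 : ℝ)).sub_const
      (3 / 2 : ℝ)).add_const (c * t)
  have e : (fun z : E n => risingParaboloid c z t) =
      fun z : E n => ‖z‖ ^ 2 * (1 / 2) - 3 / 2 + c * t := by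
    funext z
    simp only [risingParaboloid]
    ring
  rw [e, h.fderiv]
  simp

theorem hessMatrix_risingParaboloid (c : ℝ) (x : E n) (t : ℝ) :
    hessMatrix (risingParaboloid c) x t = 1 := by
  ext i j
  simp only [hessMatrix, Matrix.of_apply, fderiv_risingParaboloid_apply]
  have h : (fun y : E n => ⟪y, EuclideanSpace.single j (1 : ℝ)⟫) =
      fun y => EuclideanSpace.proj (𝕜 := ℝ) j y := by
    funext y
    simp [EuclideanSpace.inner_single_right]
  rw [h, ContinuousLinearMap.fderiv]
  simp [Matrix.one_apply, eq_comm]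

/-- A supersolution lies above every rising paraboloid of speed `c < lam` that it
dominates on the parabolic boundary. -/
theorem ViscSupersolution.risingParaboloid_le {p lam c T τ : ℝ} {S : Set (E n)}
    {u : E n → ℝ → ℝ} (hsuper : ViscSupersolution lam p S 0 T u) (hc : c < lam)
    (hτ : τ ≤ T) (hSo : IsOpen S) (hSb : Bornology.IsBounded S)
    (hcont : ContinuousOn (fun q : E n × ℝ => u q.1 q.2) (closure S ×ˢ Icc 0 T))
    (hinit : ∀ x ∈ closure S, risingParaboloid c x 0 ≤ u x 0)
    (hlat : ∀ x ∈ frontier S, ∀ t ∈ Icc 0 τ, risingParaboloid c x t ≤ u x t) :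
    ∀ x ∈ closure S, ∀ t ∈ Icc 0 τ, risingParaboloid c x t ≤ u x t := by
  intro x hx t ht
  have hsub : closure S ×ˢ Icc 0 τ ⊆ closure S ×ˢ Icc 0 T :=
    prod_mono_right (Icc_subset_Icc_right hτ)
  obtain ⟨⟨x₀, t₀⟩, ⟨hx₀, ht₀⟩, hmin⟩ :=
    (hSb.isCompact_closure.prod isCompact_Icc).exists_isMinOn ⟨(x, t), hx, ht⟩
      ((hcont.mono hsub).sub (continuous_risingParaboloid c).continuousOn)
  have hmin' : ∀ y ∈ closure S, ∀ s ∈ Icc 0 τ,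
      u x₀ t₀ - risingParaboloid c x₀ t₀ ≤ u y s - risingParaboloid c y s :=
    fun y hy s hs => hmin (show (y, s) ∈ closure S ×ˢ Icc 0 τ from ⟨hy, hs⟩)
  suffices risingParaboloid c x₀ t₀ ≤ u x₀ t₀ by
    linarith [hmin' x hx t ht]
  simp only at hx₀ ht₀
  by_cases hS : x₀ ∈ S
  · rcases ht₀.1.eq_or_lt with h0 | h0
    · rw [← h0]
      exact hinit x₀ hx₀
    · have := hsuper x₀ hS t₀ ⟨h0, ht₀.2.trans hτ⟩ (risingParaboloid c)
        (isTestAt_risingParaboloid c x₀ t₀)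
        ⟨1, one_pos, fun y hy s hs hst _ _ => hmin' y hy s ⟨hs.1, hst.trans ht₀.2⟩⟩
        (by rw [hessMatrix_risingParaboloid]; exact Matrix.PosSemidef.one)
      rw [hessMatrix_risingParaboloid, timeDeriv_risingParaboloid, Matrix.det_one,
        Real.one_rpow, mul_one] at this
      exact absurd this hc.not_ge
  · exact hlat x₀ ⟨hx₀, by rwa [hSo.interior_eq]⟩ t₀ ht₀

/-- Lemma 3.7: supersolutions in `S ⊆ B₁` rise above `-1/2` after
time `1/λ`. -/
theorem stmt17 (n : ℕ) (hn : 1 ≤ n) (p lam : ℝ) (hp : 0 < p) (hlam : 0 < lam)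
    (S : Set (E n)) (T : ℝ) (u : E n → ℝ → ℝ)
    (hSo : IsOpen S) (hSc : Convex ℝ S) (hSb : S ⊆ ball (0 : E n) 1)
    (hT : 1 / lam ≤ T)
    (hreg : ParabolicRegular S 0 T u)
    (hsuper : ViscSupersolution lam p S 0 T u)
    (h1 : ∀ x ∈ S, -1 ≤ u x 0)
    (h2 : ∀ x ∈ frontier S, 0 ≤ u x 0) :
    ∀ x ∈ S, ∀ t ∈ Icc (1 / lam) T, -(1/2 : ℝ) ≤ u x t := by
  intro x hx t ht
  have hτ : 0 < 1 / lam := one_div_pos.mpr hlam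
  have hT0 : (0 : ℝ) ∈ Icc 0 T := ⟨le_rfl, hτ.le.trans hT⟩
  have hnorm : ∀ y ∈ closure S, ‖y‖ ^ 2 ≤ 1 := by
    intro y hy
    have : y ∈ closedBall (0 : E n) 1 := closure_ball_subset_closedBall (closure_mono hSb hy)
    have : ‖y‖ ≤ 1 := by simpa using this
    nlinarith [norm_nonneg y]
  have hbelow : ∀ c < lam, risingParaboloid c x (1 / lam) ≤ u x (1 / lam) := by
    intro c hc
    refine hsuper.risingParaboloid_le hc hT hSo (isBounded_ball.subset hSb) hreg.cont
      ?_ ?_ x (subset_closure hx) (1 / lam) ⟨hτ.le, le_rfl⟩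
    · intro y hy
      have hu : -1 ≤ u y 0 := by
        by_cases hyS : y ∈ S
        · exact h1 y hyS
        · linarith [h2 y ⟨hy, by rwa [hSo.interior_eq]⟩]
      simp only [risingParaboloid]
      linarith [hnorm y hy]
    · intro y hy s hs
      have hmono := hreg.mono y hy.1 0 hT0 s ⟨hs.1, hs.2.trans hT⟩ hs.1
      have hcs : c * s ≤ 1 := by
        have h3 : lam * s ≤ lam * (1 / lam) := mul_le_mul_of_nonneg_left hs.2 hlam.le
        rw [mul_one_div_cancel hlam.ne'] at h3
        exact (mul_le_mul_of_nonneg_right hc.le hs.1).trans h3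
      simp only [risingParaboloid]
      linarith [hnorm y hy.1, h2 y hy]
  have hlim : ‖x‖ ^ 2 / 2 - 3 / 2 + lam * (1 / lam) ≤ u x (1 / lam) := by
    have : lam ≤ (u x (1 / lam) - (‖x‖ ^ 2 / 2 - 3 / 2)) / (1 / lam) := by
      refine le_of_forall_lt_imp_le_of_dense fun c hc => ?_
      rw [le_div_iff₀ hτ]
      have := hbelow c hc
      simp only [risingParaboloid] at this
      linarith
    rw [le_div_iff₀ hτ] at this
    linarith
  rw [mul_one_div_cancel hlam.ne'] at hlim
  have hmono := hreg.mono x (subset_closure hx) (1 / lam) ⟨hτ.le, hT⟩ t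
    ⟨hτ.le.trans ht.1, ht.2⟩ ht.1
  linarith [sq_nonneg ‖x‖]
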